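/- All positions of a maximal abstract path have the same caller: if positions i and i' both lie on the same maximal abstract path of a word σ over a pushdown alphabet, then SUCC(caller, σ, i) = SUCC(caller, σ, i') (both defined and equal, or both undefined). -/

import Mathlib

inductive SymKind where
  | call | ret | intl
deriving DecidableEq

/-- Well-matched words over a pushdown alphabet, where `k` assigns to each
letter its kind (call, return, or internal). -/
inductive WellMatched {A : Type*} (k : A → SymKind) : List A → Prop
  | nil : WellMatched k []
  | int {a : A} {s : List A} : k a = SymKind.intl → WellMatched k s →
      WellMatched k (a :: s)
  | matched {c r : A} {s s' : List A} : k c = SymKind.call → k r = SymKind.ret →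
      WellMatched k s → WellMatched k s' →
      WellMatched k (c :: (s ++ r :: s'))

/-- Number of call symbols in a finite word. -/
def callCount {A : Type*} (k : A → SymKind) (s : List A) : ℕ :=
  s.countP (fun a => decide (k a = SymKind.call))

/-- Number of return symbols in a finite word. -/
def retCount {A : Type*} (k : A → SymKind) (s : List A) : ℕ :=
  s.countP (fun a => decide (k a = SymKind.ret))

/-- The finite subword `σ[i, j-1]` of the infinite word `σ` (letters at
positions `i, i+1, ..., j-1`). -/
def wordSlice {A : Type*} (σ : ℕ → A) (i j : ℕ) : List A :=
  (List.range (j - i)).map fun n => σ (i + n)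

/-- `j` is a matching return of position `i`: `j > i`, `j` is a return
position, and the subword `σ[i+1, j-1]` is well-matched. -/
def MatchRet {A : Type*} (k : A → SymKind) (σ : ℕ → A) (i j : ℕ) : Prop :=
  i < j ∧ k (σ j) = SymKind.ret ∧ WellMatched k (wordSlice σ (i + 1) j)

/-- The abstract-successor relation `SUCC(abs, σ, i) = j`. -/
def AbsSucc {A : Type*} (k : A → SymKind) (σ : ℕ → A) (i j : ℕ) : Prop :=
  if k (σ i) = SymKind.call then MatchRet k σ i j
  else j = i + 1 ∧ k (σ (i + 1)) ≠ SymKind.ret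

/-- `j` is a candidate caller of `i`: a call position `j < i` whose abstract
successor is undefined or greater than `i`. -/
def CallerCand {A : Type*} (k : A → SymKind) (σ : ℕ → A) (i j : ℕ) : Prop :=
  j < i ∧ k (σ j) = SymKind.call ∧ ∀ m, AbsSucc k σ j m → i < m

/-- `j` is the caller of `i`: the greatest candidate caller. -/
def Caller {A : Type*} (k : A → SymKind) (σ : ℕ → A) (i j : ℕ) : Prop :=
  CallerCand k σ i j ∧ ∀ j', CallerCand k σ i j' → j' ≤ j

/-- `S` is a maximal abstract path (MAP): the set of positions reachable via
the abstract successor from a position `i0` with no abstract predecessor. -/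
def IsMAP {A : Type*} (k : A → SymKind) (σ : ℕ → A) (S : Set ℕ) : Prop :=
  ∃ i0, (¬ ∃ p, AbsSucc k σ p i0) ∧
    S = {j | Relation.ReflTransGen (AbsSucc k σ) i0 j}

/-- The set of positions of the (unique) maximal abstract path visiting `i`. -/
def PosA {A : Type*} (k : A → SymKind) (σ : ℕ → A) (i : ℕ) : Set ℕ :=
  {j | Relation.ReflTransGen (AbsSucc k σ) i j ∨
       Relation.ReflTransGen (AbsSucc k σ) j i}

/-- The set of positions of the caller path of `σ` from `i`. -/
def PosC {A : Type*} (k : A → SymKind) (σ : ℕ → A) (i : ℕ) : Set ℕ :=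
  {j | Relation.ReflTransGen (fun a b => Caller k σ a b) i j}

def symWt : SymKind → ℤ
  | .call => 1
  | .ret => -1
  | .intl => 0

/-- Stack height of the prefix of length `n`. -/
def hgt {A : Type*} (k : A → SymKind) (σ : ℕ → A) : ℕ → ℤ
  | 0 => 0
  | n + 1 => hgt k σ n + symWt (k (σ n))

theorem hgt_succ {A : Type*} (k : A → SymKind) (σ : ℕ → A) (n : ℕ) :
    hgt k σ (n + 1) = hgt k σ n + symWt (k (σ n)) := rfl

theorem eq_slice {A : Type*} (σ : ℕ → A) (s : List A) (a b : ℕ) (hb : b = a + s.length)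
    (h : ∀ n, n < s.length → s[n]? = some (σ (a + n))) : wordSlice σ a b = s := by
  subst hb
  apply List.ext_getElem
  · simp [wordSlice]
  · intro n h1 h2
    have := h n h2
    rw [List.getElem?_eq_getElem h2] at this
    simp only [Option.some.injEq] at this
    simp [wordSlice, this]

theorem wm_main {A : Type*} (k : A → SymKind) (σ : ℕ → A) (s : List A) (hs : WellMatched k s) :
    ∀ a, (∀ n, n < s.length → s[n]? = some (σ (a + n))) →
      hgt k σ (a + s.length) = hgt k σ a ∧
      (∀ n, n ≤ s.length → hgt k σ a ≤ hgt k σ (a + n)) ∧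
      (∀ n, n < s.length → k (σ (a + n)) = SymKind.call →
        ∃ m, m < a + s.length ∧ MatchRet k σ (a + n) m) := by
  induction hs with
  | nil =>
    intro a _
    refine ⟨rfl, ?_, ?_⟩
    · intro n hn
      simp at hn
      simp [hn]
    · intro n hn
      simp at hn
  | @int x s hx _ ih =>
    intro a h
    have h0 : x = σ a := by simpa using h 0 (by simp)
    have hh : hgt k σ (a + 1) = hgt k σ a := by
      rw [hgt_succ, ← h0, hx]; simp [symWt]
    obtain ⟨i1, i2, i3⟩ := ih (a + 1) (fun n hn => by
      have := h (n + 1) (by simpa using hn)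
      rw [List.getElem?_cons_succ] at this
      rw [this]; congr 2; omega)
    have el : a + (x :: s).length = a + 1 + s.length := by simp; omega
    rw [el]
    refine ⟨by rw [i1, hh], ?_, ?_⟩
    · intro n hn
      cases n with
      | zero => exact le_rfl
      | succ n =>
        have := i2 n (by simpa using hn)
        rw [show a + (n + 1) = a + 1 + n by omega]; omega
    · intro n hn hc
      cases n with
      | zero => rw [add_zero, ← h0, hx] at hc; cases hc
      | succ n =>
        rw [show a + (n + 1) = a + 1 + n by omega] at hc ⊢
        exact i3 n (by simpa using hn) hc
  | @matched c r s s' hc hr ws _ ih ih' =>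
    intro a h
    have h0 : c = σ a := by simpa using h 0 (by simp)
    have hs1 : ∀ n, n < s.length → s[n]? = some (σ (a + 1 + n)) := fun n hn => by
      have := h (n + 1) (by simp; omega)
      rw [List.getElem?_cons_succ, List.getElem?_append_left hn] at this
      rw [this]; congr 2; omega
    have hr1 : r = σ (a + 1 + s.length) := by
      have := h (s.length + 1) (by simp)
      rw [List.getElem?_cons_succ, List.getElem?_append_right le_rfl] at this
      simp at this
      rw [this]; congr 1; omega
    have hs2 : ∀ n, n < s'.length → s'[n]? = some (σ (a + 1 + s.length + 1 + n)) := fun n hn => by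
      have := h (s.length + 1 + n + 1) (by simp; omega)
      rw [List.getElem?_cons_succ, List.getElem?_append_right (by omega),
        show s.length + 1 + n - s.length = n + 1 by omega, List.getElem?_cons_succ] at this
      rw [this]; congr 2; omega
    obtain ⟨i1, i2, i3⟩ := ih _ hs1
    obtain ⟨j1, j2, j3⟩ := ih' _ hs2
    have e1 : hgt k σ (a + 1) = hgt k σ a + 1 := by
      rw [hgt_succ, ← h0, hc]; simp [symWt]
    have e2 : hgt k σ (a + 1 + s.length + 1) = hgt k σ a := by
      rw [hgt_succ, ← hr1, hr, i1, e1]; simp [symWt]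
    have el : (c :: (s ++ r :: s')).length = s.length + s'.length + 2 := by simp; omega
    have el' : a + (s.length + s'.length + 2) = a + 1 + s.length + 1 + s'.length := by omega
    rw [el, el']
    refine ⟨by rw [j1, e2], ?_, ?_⟩
    · intro n hn
      rcases Nat.eq_zero_or_pos n with rfl | hp
      · exact le_rfl
      by_cases hle : n ≤ s.length + 1
      · have := i2 (n - 1) (by omega)
        rw [show a + 1 + (n - 1) = a + n by omega] at this
        omega
      · have := j2 (n - (s.length + 2)) (by omega)
        rw [show a + 1 + s.length + 1 + (n - (s.length + 2)) = a + n by omega] at this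
        omega
    · intro n hn hcn
      rcases Nat.eq_zero_or_pos n with rfl | hp
      · refine ⟨a + 1 + s.length, by omega, by omega, by rw [← hr1, hr], ?_⟩
        rw [eq_slice σ s _ _ rfl hs1]
        exact ws
      by_cases hle : n ≤ s.length
      · rw [show a + n = a + 1 + (n - 1) by omega] at hcn ⊢
        obtain ⟨m, hm, hm'⟩ := i3 (n - 1) (by omega) hcn
        exact ⟨m, by omega, hm'⟩
      · by_cases hq : n = s.length + 1
        · rw [show a + n = a + 1 + s.length by omega, ← hr1, hr] at hcn
          cases hcn
        · rw [show a + n = a + 1 + s.length + 1 + (n - (s.length + 2)) by omega] at hcn ⊢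
          exact j3 (n - (s.length + 2)) (by omega) hcn

theorem match_main {A : Type*} {k : A → SymKind} {σ : ℕ → A} {i j : ℕ} (h : MatchRet k σ i j) :
    hgt k σ j = hgt k σ (i + 1) ∧
    (∀ n, i + 1 ≤ n → n ≤ j → hgt k σ (i + 1) ≤ hgt k σ n) ∧
    (∀ n, i < n → n < j → k (σ n) = SymKind.call → ∃ m, m < j ∧ MatchRet k σ n m) := by
  obtain ⟨hij, _, hw⟩ := h
  have hl : (wordSlice σ (i + 1) j).length = j - (i + 1) := by simp [wordSlice]
  obtain ⟨p1, p2, p3⟩ := wm_main k σ _ hw (i + 1) (fun n hn => by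
    rw [hl] at hn
    simp [wordSlice, hn])
  rw [hl] at p1 p2 p3
  rw [show i + 1 + (j - (i + 1)) = j by omega] at p1 p3
  refine ⟨p1, ?_, ?_⟩
  · intro n h1 h2
    have := p2 (n - (i + 1)) (by omega)
    rwa [show i + 1 + (n - (i + 1)) = n by omega] at this
  · intro n h1 h2 hc
    have := p3 (n - (i + 1)) (by omega)
    rw [show i + 1 + (n - (i + 1)) = n by omega] at this
    exact this hc

theorem cand_step {A : Type*} {k : A → SymKind} {σ : ℕ → A} {i j : ℕ} (h : AbsSucc k σ i j)
    (c : ℕ) : CallerCand k σ i c ↔ CallerCand k σ j c := by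
  by_cases hi : k (σ i) = SymKind.call
  · have hm : MatchRet k σ i j := by simpa [AbsSucc, hi] using h
    obtain ⟨p1, p2, p3⟩ := match_main hm
    have hij := hm.1
    constructor
    · rintro ⟨h1, h2, h3⟩
      refine ⟨by omega, h2, fun m hcm => ?_⟩
      have him := h3 m hcm
      have hcm' : MatchRet k σ c m := by simpa [AbsSucc, h2] using hcm
      obtain ⟨q1, q2, _⟩ := match_main hcm'
      by_contra hlt
      have a1 := p2 m (by omega) (by omega)
      have a2 := q2 i (by omega) (by omega)
      have a3 : hgt k σ (i + 1) = hgt k σ i + 1 := by rw [hgt_succ, hi]; rfl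
      omega
    · rintro ⟨h1, h2, h3⟩
      have hci : c < i := by
        by_contra hge
        rcases Nat.eq_or_lt_of_le (not_lt.mp hge) with rfl | hlt
        · exact absurd (h3 j h) (lt_irrefl _)
        · obtain ⟨m, hm1, hm2⟩ := p3 c hlt h1 h2
          have := h3 m (by simpa [AbsSucc, h2] using hm2)
          omega
      exact ⟨hci, h2, fun m hcm => lt_trans hij (h3 m hcm)⟩
  · have hm : j = i + 1 ∧ k (σ (i + 1)) ≠ SymKind.ret := by simpa [AbsSucc, hi] using h
    obtain ⟨rfl, hr⟩ := hm
    constructor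
    · rintro ⟨h1, h2, h3⟩
      refine ⟨by omega, h2, fun m hcm => ?_⟩
      have him := h3 m hcm
      have hcm' : MatchRet k σ c m := by simpa [AbsSucc, h2] using hcm
      have : m ≠ i + 1 := by
        rintro rfl
        exact hr hcm'.2.1
      omega
    · rintro ⟨h1, h2, h3⟩
      have : c ≠ i := by
        rintro rfl
        exact hi h2
      exact ⟨by omega, h2, fun m hcm => by have := h3 m hcm; omega⟩

theorem cand_path {A : Type*} {k : A → SymKind} {σ : ℕ → A} {i j : ℕ}
    (h : Relation.ReflTransGen (AbsSucc k σ) i j) (c : ℕ) :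
    CallerCand k σ i c ↔ CallerCand k σ j c := by
  induction h with
  | refl => exact Iff.rfl
  | tail _ h2 ih => exact ih.trans (cand_step h2 c)

/-- all positions of a maximal abstract path have the same
caller (both defined and equal, or both undefined). -/
theorem map_same_caller {A : Type*} (k : A → SymKind) (σ : ℕ → A) {i i' : ℕ}
    (h : ∃ S : Set ℕ, IsMAP k σ S ∧ i ∈ S ∧ i' ∈ S) :
    ∀ j, Caller k σ i j ↔ Caller k σ i' j := by
  obtain ⟨S, ⟨i0, _, rfl⟩, h1, h2⟩ := h
  have e : ∀ c, CallerCand k σ i c ↔ CallerCand k σ i' c := fun c =>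
    (cand_path h1 c).symm.trans (cand_path h2 c)
  intro j
  simp only [Caller, e]
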